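/- There exists a nonzero homogeneous polynomial of degree 36 in ℝ[x,y,z,w] that vanishes to order at least 10 at every one of the 60 points of the H4 configuration. In particular, α(I(H4)^{(10)}) ≤ 36. -/

import Mathlib

open MvPolynomial

/-- A polynomial `F ∈ ℝ[x,y,z,w]` vanishes to order at least `m` at a point with
representative vector `v` if all partial derivatives of `F` of total order less
than `m` vanish at `v`. -/
def vanishesToOrderR (F : MvPolynomial (Fin 4) ℝ) (v : Fin 4 → ℝ) (m : ℕ) : Prop :=
  ∀ l : List (Fin 4), l.length < m →
    eval v (l.foldl (fun G i => pderiv i G) F) = 0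

/-- The least degree of a nonzero homogeneous polynomial vanishing to order at least `m`
at every point of the configuration `Z`. -/
noncomputable def alphaSymbolicR (Z : Set (Fin 4 → ℝ)) (m : ℕ) : ℕ :=
  sInf { d | ∃ F : MvPolynomial (Fin 4) ℝ, F ≠ 0 ∧ F.IsHomogeneous d ∧
    ∀ v ∈ Z, vanishesToOrderR F v m }

/-- The golden ratio. -/
noncomputable def gr : ℝ := (1 + Real.sqrt 5) / 2

/-- The H4 configuration: 60 points of `ℙ³` consisting of the 4 coordinate points, the
8 points `(1:±1:±1:±1)`, and the 48 points whose coordinate vectors are the even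
permutations of `(φ, ±1, ±φ⁻¹, 0)`, where `φ` is the golden ratio. -/
noncomputable def H4Config : Set (Fin 4 → ℝ) :=
  { v | ∃ i : Fin 4, v = Pi.single i 1 } ∪
  { v | v 0 = 1 ∧ ∀ i : Fin 4, i ≠ 0 → (v i = 1 ∨ v i = -1) } ∪
  { v | ∃ σ : Equiv.Perm (Fin 4), Equiv.Perm.sign σ = 1 ∧
      ∃ ε₁ ε₂ : ℝ, (ε₁ = 1 ∨ ε₁ = -1) ∧ (ε₂ = 1 ∨ ε₂ = -1) ∧
        v = fun i => ![gr, ε₁, ε₂ * gr⁻¹, 0] (σ i) }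



/-! ### The ring `ℤ[φ]` and the 120 icosians -/

/-- Pairs `(a, b)` stand for `a + b φ`. -/
abbrev Zp := ℤ × ℤ
abbrev Tri := Zp × Zp × Zp
abbrev Pt := Zp × Zp × Zp × Zp

def zadd (a b : Zp) : Zp := (a.1 + b.1, a.2 + b.2)
def zsub (a b : Zp) : Zp := (a.1 - b.1, a.2 - b.2)
def zmul (a b : Zp) : Zp := (a.1 * b.1 + a.2 * b.2, a.1 * b.2 + a.2 * b.1 + a.2 * b.2)
def zpow (a : Zp) : ℕ → Zp
  | 0 => (1, 0)
  | n + 1 => zmul a (zpow a n)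

/-- Quaternion multiplication over `ℤ[φ]`. -/
def qmul (a b : Pt) : Pt :=
  (zsub (zsub (zsub (zmul a.1 b.1) (zmul a.2.1 b.2.1)) (zmul a.2.2.1 b.2.2.1))
     (zmul a.2.2.2 b.2.2.2),
   zsub (zadd (zadd (zmul a.1 b.2.1) (zmul a.2.1 b.1)) (zmul a.2.2.1 b.2.2.2))
     (zmul a.2.2.2 b.2.2.1),
   zadd (zadd (zsub (zmul a.1 b.2.2.1) (zmul a.2.1 b.2.2.2)) (zmul a.2.2.1 b.1))
     (zmul a.2.2.2 b.2.1),
   zadd (zsub (zadd (zmul a.1 b.2.2.2) (zmul a.2.1 b.2.2.1)) (zmul a.2.2.1 b.2.1))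
     (zmul a.2.2.2 b.1))

def psmul (k : ℤ) (a : Pt) : Pt :=
  ((k * a.1.1, k * a.1.2), (k * a.2.1.1, k * a.2.1.2),
   (k * a.2.2.1.1, k * a.2.2.1.2), (k * a.2.2.2.1, k * a.2.2.2.2))

/-- Shell of first coordinate `φ` (an icosahedron). -/
def SI : List Tri :=
  [((1, 0), (1, -1), (0, 0)),((1, 0), (-1, 1), (0, 0)),((1, -1), (0, 0), (1, 0)),
   ((1, -1), (0, 0), (-1, 0)),((0, 0), (1, 0), (1, -1)),((0, 0), (1, 0), (-1, 1)),
   ((0, 0), (-1, 0), (1, -1)),((0, 0), (-1, 0), (-1, 1)),((-1, 1), (0, 0), (1, 0)),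
   ((-1, 1), (0, 0), (-1, 0)),((-1, 0), (1, -1), (0, 0)),((-1, 0), (-1, 1), (0, 0))]
/-- Shell of first coordinate `1` (a dodecahedron). -/
def SD : List Tri :=
  [((1, 0), (1, 0), (1, 0)),((1, 0), (1, 0), (-1, 0)),((1, 0), (-1, 0), (1, 0)),
   ((1, 0), (-1, 0), (-1, 0)),((1, -1), (0, 1), (0, 0)),((1, -1), (0, -1), (0, 0)),
   ((0, 1), (0, 0), (1, -1)),((0, 1), (0, 0), (-1, 1)),((0, 0), (1, -1), (0, 1)),
   ((0, 0), (1, -1), (0, -1)),((0, 0), (-1, 1), (0, 1)),((0, 0), (-1, 1), (0, -1)),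
   ((0, -1), (0, 0), (1, -1)),((0, -1), (0, 0), (-1, 1)),((-1, 1), (0, 1), (0, 0)),
   ((-1, 1), (0, -1), (0, 0)),((-1, 0), (1, 0), (1, 0)),((-1, 0), (1, 0), (-1, 0)),
   ((-1, 0), (-1, 0), (1, 0)),((-1, 0), (-1, 0), (-1, 0))]
/-- Shell of first coordinate `φ⁻¹` (an icosahedron). -/
def SJ : List Tri :=
  [((1, 0), (0, 0), (0, 1)),((1, 0), (0, 0), (0, -1)),((0, 1), (1, 0), (0, 0)),
   ((0, 1), (-1, 0), (0, 0)),((0, 0), (0, 1), (1, 0)),((0, 0), (0, 1), (-1, 0)),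
   ((0, 0), (0, -1), (1, 0)),((0, 0), (0, -1), (-1, 0)),((0, -1), (1, 0), (0, 0)),
   ((0, -1), (-1, 0), (0, 0)),((-1, 0), (0, 0), (0, 1)),((-1, 0), (0, 0), (0, -1))]
/-- Shell of first coordinate `0` (an icosidodecahedron). -/
def SE : List Tri :=
  [((2, 0), (0, 0), (0, 0)),((1, 0), (0, 1), (1, -1)),((1, 0), (0, 1), (-1, 1)),
   ((1, 0), (0, -1), (1, -1)),((1, 0), (0, -1), (-1, 1)),((1, -1), (1, 0), (0, 1)),
   ((1, -1), (1, 0), (0, -1)),((1, -1), (-1, 0), (0, 1)),((1, -1), (-1, 0), (0, -1)),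
   ((0, 1), (1, -1), (1, 0)),((0, 1), (1, -1), (-1, 0)),((0, 1), (-1, 1), (1, 0)),
   ((0, 1), (-1, 1), (-1, 0)),((0, 0), (2, 0), (0, 0)),((0, 0), (0, 0), (2, 0)),
   ((0, 0), (0, 0), (-2, 0)),((0, 0), (-2, 0), (0, 0)),((0, -1), (1, -1), (1, 0)),
   ((0, -1), (1, -1), (-1, 0)),((0, -1), (-1, 1), (1, 0)),((0, -1), (-1, 1), (-1, 0)),
   ((-1, 1), (1, 0), (0, 1)),((-1, 1), (1, 0), (0, -1)),((-1, 1), (-1, 0), (0, 1)),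
   ((-1, 1), (-1, 0), (0, -1)),((-1, 0), (0, 1), (1, -1)),((-1, 0), (0, 1), (-1, 1)),
   ((-1, 0), (0, -1), (1, -1)),((-1, 0), (0, -1), (-1, 1)),((-2, 0), (0, 0), (0, 0))]

def pts : List Pt :=
  ((2, 0), (0, 0), (0, 0), (0, 0)) :: ((-2, 0), (0, 0), (0, 0), (0, 0)) ::
  (SI.map (fun b => ((0, 1), b)) ++ (SI.map (fun b => ((0, -1), b)) ++
  (SD.map (fun b => ((1, 0), b)) ++ (SD.map (fun b => ((-1, 0), b)) ++
  (SJ.map (fun b => ((-1, 1), b)) ++ (SJ.map (fun b => ((1, -1), b)) ++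
  SE.map (fun b => ((0, 0), b))))))))

def gA : Pt := ((0, 1), (1, 0), (-1, 1), (0, 0))
def gW : Pt := ((1, 0), (1, 0), (1, 0), (1, 0))
def gI : Pt := ((0, 0), (2, 0), (0, 0), (0, 0))
def gJ : Pt := ((0, 0), (0, 0), (2, 0), (0, 0))

theorem perm_A : (pts.map (qmul gA)).Perm (pts.map (psmul 2)) := by decide +kernel
theorem perm_W : (pts.map (qmul gW)).Perm (pts.map (psmul 2)) := by decide +kernel
theorem perm_I : (pts.map (qmul gI)).Perm (pts.map (psmul 2)) := by decide +kernel
theorem perm_J : (pts.map (qmul gJ)).Perm (pts.map (psmul 2)) := by decide +kernel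

def words : List (ℕ × ℕ × ℕ × ℕ) :=
  [(0, 0, 0, 0),(0, 0, 2, 0),(2, 1, 3, 0),(1, 0, 0, 0),(2, 0, 3, 0),(1, 2, 2, 0),(2, 2, 2, 0),(4, 1, 2, 0),
   (3, 2, 0, 1),(1, 1, 3, 0),(3, 0, 3, 0),(4, 2, 0, 1),(4, 0, 2, 0),(3, 1, 2, 0),(3, 1, 0, 0),(4, 0, 0, 0),
   (4, 2, 2, 1),(3, 0, 1, 0),(1, 1, 1, 0),(3, 2, 2, 1),(4, 1, 0, 0),(2, 2, 0, 0),(1, 2, 0, 0),(2, 0, 1, 0),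
   (1, 0, 2, 0),(2, 1, 1, 0),(0, 1, 0, 0),(0, 2, 2, 1),(0, 2, 3, 0),(0, 1, 2, 1),(1, 1, 3, 1),(2, 2, 0, 1),
   (3, 1, 3, 0),(4, 0, 3, 0),(4, 2, 1, 0),(2, 0, 2, 1),(1, 2, 3, 1),(3, 0, 2, 1),(2, 1, 2, 0),(1, 0, 3, 0),
   (3, 2, 2, 0),(4, 1, 0, 1),(0, 2, 3, 1),(0, 1, 3, 1),(0, 1, 3, 0),(0, 2, 2, 0),(0, 2, 0, 0),(0, 1, 1, 0),
   (0, 1, 1, 1),(0, 2, 1, 1),(4, 1, 2, 1),(3, 2, 0, 0),(1, 0, 1, 0),(2, 1, 0, 0),(3, 0, 0, 1),(1, 2, 1, 1),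
   (2, 0, 0, 1),(4, 2, 3, 0),(4, 0, 1, 0),(3, 1, 1, 0),(2, 2, 2, 1),(1, 1, 1, 1),(0, 1, 0, 1),(0, 2, 1, 0),
   (0, 2, 0, 1),(0, 1, 2, 0),(2, 2, 3, 1),(1, 1, 2, 1),(2, 0, 0, 0),(1, 2, 3, 0),(2, 1, 3, 1),(4, 0, 2, 1),
   (3, 1, 0, 1),(1, 0, 2, 1),(4, 2, 1, 1),(3, 0, 2, 0),(3, 2, 1, 0),(4, 1, 1, 1),(4, 1, 3, 1),(3, 2, 3, 0),
   (3, 0, 0, 0),(4, 2, 3, 1),(1, 0, 0, 1),(3, 1, 2, 1),(4, 0, 0, 1),(2, 1, 1, 1),(1, 2, 1, 0),(2, 0, 2, 0),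
   (1, 1, 0, 1),(2, 2, 1, 1),(0, 0, 1, 0),(1, 2, 2, 1),(4, 2, 2, 0),(3, 0, 1, 1),(2, 0, 1, 1),(4, 0, 3, 1),
   (1, 0, 3, 1),(2, 1, 0, 1),(3, 1, 1, 1),(3, 2, 3, 1),(2, 2, 3, 0),(1, 1, 0, 0),(4, 1, 3, 0),(0, 0, 0, 1),
   (0, 0, 1, 1),(0, 0, 3, 1),(0, 0, 2, 1),(4, 1, 1, 0),(1, 1, 2, 0),(2, 2, 1, 0),(3, 2, 1, 1),(3, 1, 3, 1),
   (2, 1, 2, 1),(1, 0, 1, 1),(4, 0, 1, 1),(2, 0, 3, 1),(3, 0, 3, 1),(4, 2, 0, 0),(1, 2, 0, 1),(0, 0, 3, 0)]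

def word (t : ℕ × ℕ × ℕ × ℕ) : Pt :=
  (qmul gA)^[t.1] ((qmul gW)^[t.2.1] ((qmul gI)^[t.2.2.1] ((qmul gJ)^[t.2.2.2]
    ((2, 0), (0, 0), (0, 0), (0, 0)))))

theorem words_eq : words.map word =
    List.zipWith (fun t P => psmul (2 ^ (t.1 + t.2.1 + t.2.2.1 + t.2.2.2)) P) words pts := by
  decide +kernel

theorem words_len : words.length = pts.length := by decide +kernel

theorem exists_word (P : Pt) (hP : P ∈ pts) : ∃ t : ℕ × ℕ × ℕ × ℕ, ∃ k : ℕ,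
    word t = psmul (2 ^ k) P := by
  obtain ⟨i, hi, rfl⟩ := List.mem_iff_getElem.1 hP
  have hi' : i < words.length := by rw [words_len]; exact hi
  have h := congrArg (fun l => l[i]?) words_eq
  simp only [List.getElem?_map, List.getElem?_zipWith, List.getElem?_eq_getElem hi,
    List.getElem?_eq_getElem hi', Option.map_some, Option.some.injEq] at h
  exact ⟨_, _, h⟩

/-! ### Evaluation in commutative rings -/

section Ring
variable {R : Type*} [CommRing R]

def ez (φ : R) (a : Zp) : R := (a.1 : R) + (a.2 : R) * φ

def lin3 (φ y z w : R) (b : Tri) : R := ez φ b.1 * y + ez φ b.2.1 * z + ez φ b.2.2 * w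

def ell (φ x y z w : R) (P : Pt) : R := ez φ P.1 * x + lin3 φ y z w P.2

def ps (n : ℕ) (φ x y z w : R) : R := (pts.map (fun P => ell φ x y z w P ^ n)).sum

def sq4 (x y z w : R) : R := x ^ 2 + y ^ 2 + z ^ 2 + w ^ 2

def comb36 (s a b c : R) : R :=
  ((-114290627257727020800 : ℤ) : R) * s ^ 18 + ((7489771812432000 : ℤ) : R) * (s ^ 12 * a)
  + ((-926436420 : ℤ) : R) * (s ^ 6 * a ^ 2) + ((2431 : ℤ) : R) * a ^ 3
  + ((-2046584685600 : ℤ) : R) * (s ^ 8 * b) + ((-687960 : ℤ) : R) * (s ^ 2 * a * b)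
  + ((19192320 : ℤ) : R) * (s ^ 3 * c)

def F36 (φ x y z w : R) : R :=
  comb36 (sq4 x y z w) (ps 12 φ x y z w) (ps 20 φ x y z w) (ps 30 φ x y z w)

theorem ez_add (φ : R) (a b : Zp) : ez φ (zadd a b) = ez φ a + ez φ b := by
  simp only [ez, zadd]; push_cast; ring
theorem ez_sub (φ : R) (a b : Zp) : ez φ (zsub a b) = ez φ a - ez φ b := by
  simp only [ez, zsub]; push_cast; ring
theorem ez_mul (φ : R) (h : φ ^ 2 = φ + 1) (a b : Zp) :
    ez φ (zmul a b) = ez φ a * ez φ b := by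
  simp only [ez, zmul]; push_cast; linear_combination (-(a.2 : R) * b.2) * h
theorem ez_pow (φ : R) (h : φ ^ 2 = φ + 1) (a : Zp) (n : ℕ) :
    ez φ (zpow a n) = ez φ a ^ n := by
  induction n with
  | zero => simp [ez, zpow]
  | succ n ih => rw [zpow, ez_mul φ h, ih, pow_succ']

theorem phi_pow (φ : R) (h : φ ^ 2 = φ + 1) (n : ℕ) :
    φ ^ (n + 1) = (Nat.fib (n + 1) : R) * φ + (Nat.fib n : R) := by
  induction n with
  | zero => simp
  | succ n ih =>
    rw [pow_succ, ih, Nat.fib_add_two]; push_cast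
    linear_combination (Nat.fib (n + 1) : R) * h

/-! ### Local expansion at `(1:0:0:0)` -/

def qq (y z w : R) : R := y ^ 2 + z ^ 2 + w ^ 2

def gg (φ y z w : R) : R :=
  4 * (y ^ 2 * z ^ 2 * w ^ 2) - φ * (y ^ 4 * z ^ 2 + z ^ 4 * w ^ 2 + w ^ 4 * y ^ 2)
  + (φ - 1) * (y ^ 4 * w ^ 2 + z ^ 4 * y ^ 2 + w ^ 4 * z ^ 2)

theorem pair_12 (A L : R) (h : L ^ 10 = 0) : (A + L) ^ 12 + (-A + L) ^ 12 =
    2 * A ^ 12 * L ^ 0 + 132 * A ^ 10 * L ^ 2 + 990 * A ^ 8 * L ^ 4 + 1848 * A ^ 6 * L ^ 6 + 990 * A ^ 4 * L ^ 8 := by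
  linear_combination (132 * A ^ 2 * L ^ 0 + 2 * A ^ 0 * L ^ 2) * h

theorem shell_12 (S : List Tri) (l : Tri → R) (h : ∀ b, l b ^ 10 = 0) (A : R) :
    (S.map (fun b => (A + l b) ^ 12)).sum + (S.map (fun b => (-A + l b) ^ 12)).sum =
    2 * A ^ 12 * (S.map (fun b => l b ^ 0)).sum + 132 * A ^ 10 * (S.map (fun b => l b ^ 2)).sum + 990 * A ^ 8 * (S.map (fun b => l b ^ 4)).sum + 1848 * A ^ 6 * (S.map (fun b => l b ^ 6)).sum + 990 * A ^ 4 * (S.map (fun b => l b ^ 8)).sum := by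
  induction S with
  | nil => simp
  | cons b S ih =>
    simp only [List.map_cons, List.sum_cons]
    linear_combination ih + pair_12 A (l b) (h b)

theorem pair_20 (A L : R) (h : L ^ 10 = 0) : (A + L) ^ 20 + (-A + L) ^ 20 =
    2 * A ^ 20 * L ^ 0 + 380 * A ^ 18 * L ^ 2 + 9690 * A ^ 16 * L ^ 4 + 77520 * A ^ 14 * L ^ 6 + 251940 * A ^ 12 * L ^ 8 := by
  linear_combination (369512 * A ^ 10 * L ^ 0 + 251940 * A ^ 8 * L ^ 2 + 77520 * A ^ 6 * L ^ 4 + 9690 * A ^ 4 * L ^ 6 + 380 * A ^ 2 * L ^ 8 + 2 * A ^ 0 * L ^ 10) * h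

theorem shell_20 (S : List Tri) (l : Tri → R) (h : ∀ b, l b ^ 10 = 0) (A : R) :
    (S.map (fun b => (A + l b) ^ 20)).sum + (S.map (fun b => (-A + l b) ^ 20)).sum =
    2 * A ^ 20 * (S.map (fun b => l b ^ 0)).sum + 380 * A ^ 18 * (S.map (fun b => l b ^ 2)).sum + 9690 * A ^ 16 * (S.map (fun b => l b ^ 4)).sum + 77520 * A ^ 14 * (S.map (fun b => l b ^ 6)).sum + 251940 * A ^ 12 * (S.map (fun b => l b ^ 8)).sum := by
  induction S with
  | nil => simp
  | cons b S ih =>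
    simp only [List.map_cons, List.sum_cons]
    linear_combination ih + pair_20 A (l b) (h b)

theorem pair_30 (A L : R) (h : L ^ 10 = 0) : (A + L) ^ 30 + (-A + L) ^ 30 =
    2 * A ^ 30 * L ^ 0 + 870 * A ^ 28 * L ^ 2 + 54810 * A ^ 26 * L ^ 4 + 1187550 * A ^ 24 * L ^ 6 + 11705850 * A ^ 22 * L ^ 8 := by
  linear_combination (60090030 * A ^ 20 * L ^ 0 + 172986450 * A ^ 18 * L ^ 2 + 290845350 * A ^ 16 * L ^ 4 + 290845350 * A ^ 14 * L ^ 6 + 172986450 * A ^ 12 * L ^ 8 + 60090030 * A ^ 10 * L ^ 10 + 11705850 * A ^ 8 * L ^ 12 + 1187550 * A ^ 6 * L ^ 14 + 54810 * A ^ 4 * L ^ 16 + 870 * A ^ 2 * L ^ 18 + 2 * A ^ 0 * L ^ 20) * h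

theorem shell_30 (S : List Tri) (l : Tri → R) (h : ∀ b, l b ^ 10 = 0) (A : R) :
    (S.map (fun b => (A + l b) ^ 30)).sum + (S.map (fun b => (-A + l b) ^ 30)).sum =
    2 * A ^ 30 * (S.map (fun b => l b ^ 0)).sum + 870 * A ^ 28 * (S.map (fun b => l b ^ 2)).sum + 54810 * A ^ 26 * (S.map (fun b => l b ^ 4)).sum + 1187550 * A ^ 24 * (S.map (fun b => l b ^ 6)).sum + 11705850 * A ^ 22 * (S.map (fun b => l b ^ 8)).sum := by
  induction S with
  | nil => simp
  | cons b S ih =>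
    simp only [List.map_cons, List.sum_cons]
    linear_combination ih + pair_30 A (l b) (h b)

theorem mom_I0 (φ y z w : R) (_ : φ ^ 2 = φ + 1) :
    (SI.map (fun b => lin3 φ y z w b ^ 0)).sum = (12) * qq y z w ^ 0 := by
  norm_num [SI]

theorem mom_I2 (φ y z w : R) (h : φ ^ 2 = φ + 1) :
    (SI.map (fun b => lin3 φ y z w b ^ 2)).sum = (12 + (-4) * φ) * qq y z w ^ 1 := by
  simp only [SI, List.map_cons, List.map_nil, List.sum_cons, List.sum_nil, lin3, ez,
    qq]
  push_cast
  linear_combination (y ^ 0 * z ^ 0 * w ^ 2 * ((4) * φ ^ 0) +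
    y ^ 0 * z ^ 2 * w ^ 0 * ((4) * φ ^ 0) +
    y ^ 2 * z ^ 0 * w ^ 0 * ((4) * φ ^ 0)) * h

theorem mom_I4 (φ y z w : R) (h : φ ^ 2 = φ + 1) :
    (SI.map (fun b => lin3 φ y z w b ^ 4)).sum = (24 + (-12) * φ) * qq y z w ^ 2 := by
  simp only [SI, List.map_cons, List.map_nil, List.sum_cons, List.sum_nil, lin3, ez,
    qq]
  push_cast
  linear_combination (y ^ 0 * z ^ 0 * w ^ 4 * ((4) * φ ^ 2 + (-12) * φ ^ 1 + (16) * φ ^ 0) +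
    y ^ 0 * z ^ 2 * w ^ 2 * ((24) * φ ^ 0) +
    y ^ 0 * z ^ 4 * w ^ 0 * ((4) * φ ^ 2 + (-12) * φ ^ 1 + (16) * φ ^ 0) +
    y ^ 2 * z ^ 0 * w ^ 2 * ((24) * φ ^ 0) +
    y ^ 2 * z ^ 2 * w ^ 0 * ((24) * φ ^ 0) +
    y ^ 4 * z ^ 0 * w ^ 0 * ((4) * φ ^ 2 + (-12) * φ ^ 1 + (16) * φ ^ 0)) * h

theorem mom_I6 (φ y z w : R) (h : φ ^ 2 = φ + 1) :
    (SI.map (fun b => lin3 φ y z w b ^ 6)).sum = (56 + (-32) * φ) * qq y z w ^ 3 + (-84 + (48) * φ) * qq y z w ^ 0 * gg φ y z w := by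
  simp only [SI, List.map_cons, List.map_nil, List.sum_cons, List.sum_nil, lin3, ez,
    qq, gg]
  push_cast
  linear_combination (y ^ 0 * z ^ 0 * w ^ 6 * ((4) * φ ^ 4 + (-20) * φ ^ 3 + (44) * φ ^ 2 + (-56) * φ ^ 1 + (48) * φ ^ 0) +
    y ^ 0 * z ^ 2 * w ^ 4 * ((60) * φ ^ 2 + (-180) * φ ^ 1 + (192) * φ ^ 0) +
    y ^ 0 * z ^ 4 * w ^ 2 * ((108) * φ ^ 0) +
    y ^ 0 * z ^ 6 * w ^ 0 * ((4) * φ ^ 4 + (-20) * φ ^ 3 + (44) * φ ^ 2 + (-56) * φ ^ 1 + (48) * φ ^ 0) +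
    y ^ 2 * z ^ 0 * w ^ 4 * ((108) * φ ^ 0) +
    y ^ 2 * z ^ 4 * w ^ 0 * ((60) * φ ^ 2 + (-180) * φ ^ 1 + (192) * φ ^ 0) +
    y ^ 4 * z ^ 0 * w ^ 2 * ((60) * φ ^ 2 + (-180) * φ ^ 1 + (192) * φ ^ 0) +
    y ^ 4 * z ^ 2 * w ^ 0 * ((108) * φ ^ 0) +
    y ^ 6 * z ^ 0 * w ^ 0 * ((4) * φ ^ 4 + (-20) * φ ^ 3 + (44) * φ ^ 2 + (-56) * φ ^ 1 + (48) * φ ^ 0)) * h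

theorem mom_I8 (φ y z w : R) (h : φ ^ 2 = φ + 1) :
    (SI.map (fun b => lin3 φ y z w b ^ 8)).sum = (140 + (-84) * φ) * qq y z w ^ 4 + (-560 + (336) * φ) * qq y z w ^ 1 * gg φ y z w := by
  simp only [SI, List.map_cons, List.map_nil, List.sum_cons, List.sum_nil, lin3, ez,
    qq, gg]
  push_cast
  linear_combination (y ^ 0 * z ^ 0 * w ^ 8 * ((4) * φ ^ 6 + (-28) * φ ^ 5 + (88) * φ ^ 4 + (-164) * φ ^ 3 + (204) * φ ^ 2 + (-184) * φ ^ 1 + (132) * φ ^ 0) +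
    y ^ 0 * z ^ 2 * w ^ 6 * ((112) * φ ^ 4 + (-560) * φ ^ 3 + (1232) * φ ^ 2 + (-1568) * φ ^ 1 + (1008) * φ ^ 0) +
    y ^ 0 * z ^ 4 * w ^ 4 * ((280) * φ ^ 2 + (-840) * φ ^ 1 + (1120) * φ ^ 0) +
    y ^ 0 * z ^ 6 * w ^ 2 * ((448) * φ ^ 0) +
    y ^ 0 * z ^ 8 * w ^ 0 * ((4) * φ ^ 6 + (-28) * φ ^ 5 + (88) * φ ^ 4 + (-164) * φ ^ 3 + (204) * φ ^ 2 + (-184) * φ ^ 1 + (132) * φ ^ 0) +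
    y ^ 2 * z ^ 0 * w ^ 6 * ((448) * φ ^ 0) +
    y ^ 2 * z ^ 6 * w ^ 0 * ((112) * φ ^ 4 + (-560) * φ ^ 3 + (1232) * φ ^ 2 + (-1568) * φ ^ 1 + (1008) * φ ^ 0) +
    y ^ 4 * z ^ 0 * w ^ 4 * ((280) * φ ^ 2 + (-840) * φ ^ 1 + (1120) * φ ^ 0) +
    y ^ 4 * z ^ 4 * w ^ 0 * ((280) * φ ^ 2 + (-840) * φ ^ 1 + (1120) * φ ^ 0) +
    y ^ 6 * z ^ 0 * w ^ 2 * ((112) * φ ^ 4 + (-560) * φ ^ 3 + (1232) * φ ^ 2 + (-1568) * φ ^ 1 + (1008) * φ ^ 0) +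
    y ^ 6 * z ^ 2 * w ^ 0 * ((448) * φ ^ 0) +
    y ^ 8 * z ^ 0 * w ^ 0 * ((4) * φ ^ 6 + (-28) * φ ^ 5 + (88) * φ ^ 4 + (-164) * φ ^ 3 + (204) * φ ^ 2 + (-184) * φ ^ 1 + (132) * φ ^ 0)) * h

theorem mom_D0 (φ y z w : R) (_ : φ ^ 2 = φ + 1) :
    (SD.map (fun b => lin3 φ y z w b ^ 0)).sum = (20) * qq y z w ^ 0 := by
  norm_num [SD]

theorem mom_D2 (φ y z w : R) (h : φ ^ 2 = φ + 1) :
    (SD.map (fun b => lin3 φ y z w b ^ 2)).sum = (20) * qq y z w ^ 1 := by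
  simp only [SD, List.map_cons, List.map_nil, List.sum_cons, List.sum_nil, lin3, ez,
    qq]
  push_cast
  linear_combination (y ^ 0 * z ^ 0 * w ^ 2 * ((8) * φ ^ 0) +
    y ^ 0 * z ^ 2 * w ^ 0 * ((8) * φ ^ 0) +
    y ^ 2 * z ^ 0 * w ^ 0 * ((8) * φ ^ 0)) * h

theorem mom_D4 (φ y z w : R) (h : φ ^ 2 = φ + 1) :
    (SD.map (fun b => lin3 φ y z w b ^ 4)).sum = (36) * qq y z w ^ 2 := by
  simp only [SD, List.map_cons, List.map_nil, List.sum_cons, List.sum_nil, lin3, ez,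
    qq]
  push_cast
  linear_combination (y ^ 0 * z ^ 0 * w ^ 4 * ((8) * φ ^ 2 + (-8) * φ ^ 1 + (24) * φ ^ 0) +
    y ^ 0 * z ^ 2 * w ^ 2 * ((24) * φ ^ 2 + (-24) * φ ^ 1 + (24) * φ ^ 0) +
    y ^ 0 * z ^ 4 * w ^ 0 * ((8) * φ ^ 2 + (-8) * φ ^ 1 + (24) * φ ^ 0) +
    y ^ 2 * z ^ 0 * w ^ 2 * ((24) * φ ^ 2 + (-24) * φ ^ 1 + (24) * φ ^ 0) +
    y ^ 2 * z ^ 2 * w ^ 0 * ((24) * φ ^ 2 + (-24) * φ ^ 1 + (24) * φ ^ 0) +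
    y ^ 4 * z ^ 0 * w ^ 0 * ((8) * φ ^ 2 + (-8) * φ ^ 1 + (24) * φ ^ 0)) * h

theorem mom_D6 (φ y z w : R) (h : φ ^ 2 = φ + 1) :
    (SD.map (fun b => lin3 φ y z w b ^ 6)).sum = (80) * qq y z w ^ 3 + (60) * qq y z w ^ 0 * gg φ y z w := by
  simp only [SD, List.map_cons, List.map_nil, List.sum_cons, List.sum_nil, lin3, ez,
    qq, gg]
  push_cast
  linear_combination (y ^ 0 * z ^ 0 * w ^ 6 * ((8) * φ ^ 4 + (-16) * φ ^ 3 + (52) * φ ^ 2 + (-44) * φ ^ 1 + (68) * φ ^ 0) +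
    y ^ 0 * z ^ 2 * w ^ 4 * ((60) * φ ^ 4 + (-60) * φ ^ 3 + (60) * φ ^ 2 + (60) * φ ^ 0) +
    y ^ 0 * z ^ 4 * w ^ 2 * ((60) * φ ^ 4 + (-180) * φ ^ 3 + (240) * φ ^ 2 + (-180) * φ ^ 1 + (120) * φ ^ 0) +
    y ^ 0 * z ^ 6 * w ^ 0 * ((8) * φ ^ 4 + (-16) * φ ^ 3 + (52) * φ ^ 2 + (-44) * φ ^ 1 + (68) * φ ^ 0) +
    y ^ 2 * z ^ 0 * w ^ 4 * ((60) * φ ^ 4 + (-180) * φ ^ 3 + (240) * φ ^ 2 + (-180) * φ ^ 1 + (120) * φ ^ 0) +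
    y ^ 2 * z ^ 4 * w ^ 0 * ((60) * φ ^ 4 + (-60) * φ ^ 3 + (60) * φ ^ 2 + (60) * φ ^ 0) +
    y ^ 4 * z ^ 0 * w ^ 2 * ((60) * φ ^ 4 + (-60) * φ ^ 3 + (60) * φ ^ 2 + (60) * φ ^ 0) +
    y ^ 4 * z ^ 2 * w ^ 0 * ((60) * φ ^ 4 + (-180) * φ ^ 3 + (240) * φ ^ 2 + (-180) * φ ^ 1 + (120) * φ ^ 0) +
    y ^ 6 * z ^ 0 * w ^ 0 * ((8) * φ ^ 4 + (-16) * φ ^ 3 + (52) * φ ^ 2 + (-44) * φ ^ 1 + (68) * φ ^ 0)) * h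

theorem mom_D8 (φ y z w : R) (h : φ ^ 2 = φ + 1) :
    (SD.map (fun b => lin3 φ y z w b ^ 8)).sum = (196) * qq y z w ^ 4 + (336) * qq y z w ^ 1 * gg φ y z w := by
  simp only [SD, List.map_cons, List.map_nil, List.sum_cons, List.sum_nil, lin3, ez,
    qq, gg]
  push_cast
  linear_combination (y ^ 0 * z ^ 0 * w ^ 8 * ((8) * φ ^ 6 + (-24) * φ ^ 5 + (96) * φ ^ 4 + (-152) * φ ^ 3 + (224) * φ ^ 2 + (-152) * φ ^ 1 + (184) * φ ^ 0) +
    y ^ 0 * z ^ 2 * w ^ 6 * ((112) * φ ^ 6 + (-112) * φ ^ 5 + (112) * φ ^ 4 + (112) * φ ^ 2 + (112) * φ ^ 1 + (224) * φ ^ 0) +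
    y ^ 0 * z ^ 4 * w ^ 4 * ((280) * φ ^ 6 + (-840) * φ ^ 5 + (1120) * φ ^ 4 + (-840) * φ ^ 3 + (560) * φ ^ 2 + (-280) * φ ^ 1 + (280) * φ ^ 0) +
    y ^ 0 * z ^ 6 * w ^ 2 * ((112) * φ ^ 6 + (-560) * φ ^ 5 + (1232) * φ ^ 4 + (-1568) * φ ^ 3 + (1344) * φ ^ 2 + (-896) * φ ^ 1 + (560) * φ ^ 0) +
    y ^ 0 * z ^ 8 * w ^ 0 * ((8) * φ ^ 6 + (-24) * φ ^ 5 + (96) * φ ^ 4 + (-152) * φ ^ 3 + (224) * φ ^ 2 + (-152) * φ ^ 1 + (184) * φ ^ 0) +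
    y ^ 2 * z ^ 0 * w ^ 6 * ((112) * φ ^ 6 + (-560) * φ ^ 5 + (1232) * φ ^ 4 + (-1568) * φ ^ 3 + (1344) * φ ^ 2 + (-896) * φ ^ 1 + (560) * φ ^ 0) +
    y ^ 2 * z ^ 6 * w ^ 0 * ((112) * φ ^ 6 + (-112) * φ ^ 5 + (112) * φ ^ 4 + (112) * φ ^ 2 + (112) * φ ^ 1 + (224) * φ ^ 0) +
    y ^ 4 * z ^ 0 * w ^ 4 * ((280) * φ ^ 6 + (-840) * φ ^ 5 + (1120) * φ ^ 4 + (-840) * φ ^ 3 + (560) * φ ^ 2 + (-280) * φ ^ 1 + (280) * φ ^ 0) +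
    y ^ 4 * z ^ 4 * w ^ 0 * ((280) * φ ^ 6 + (-840) * φ ^ 5 + (1120) * φ ^ 4 + (-840) * φ ^ 3 + (560) * φ ^ 2 + (-280) * φ ^ 1 + (280) * φ ^ 0) +
    y ^ 6 * z ^ 0 * w ^ 2 * ((112) * φ ^ 6 + (-112) * φ ^ 5 + (112) * φ ^ 4 + (112) * φ ^ 2 + (112) * φ ^ 1 + (224) * φ ^ 0) +
    y ^ 6 * z ^ 2 * w ^ 0 * ((112) * φ ^ 6 + (-560) * φ ^ 5 + (1232) * φ ^ 4 + (-1568) * φ ^ 3 + (1344) * φ ^ 2 + (-896) * φ ^ 1 + (560) * φ ^ 0) +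
    y ^ 8 * z ^ 0 * w ^ 0 * ((8) * φ ^ 6 + (-24) * φ ^ 5 + (96) * φ ^ 4 + (-152) * φ ^ 3 + (224) * φ ^ 2 + (-152) * φ ^ 1 + (184) * φ ^ 0)) * h

theorem mom_J0 (φ y z w : R) (_ : φ ^ 2 = φ + 1) :
    (SJ.map (fun b => lin3 φ y z w b ^ 0)).sum = (12) * qq y z w ^ 0 := by
  norm_num [SJ]

theorem mom_J2 (φ y z w : R) (h : φ ^ 2 = φ + 1) :
    (SJ.map (fun b => lin3 φ y z w b ^ 2)).sum = (8 + (4) * φ) * qq y z w ^ 1 := by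
  simp only [SJ, List.map_cons, List.map_nil, List.sum_cons, List.sum_nil, lin3, ez,
    qq]
  push_cast
  linear_combination (y ^ 0 * z ^ 0 * w ^ 2 * ((4) * φ ^ 0) +
    y ^ 0 * z ^ 2 * w ^ 0 * ((4) * φ ^ 0) +
    y ^ 2 * z ^ 0 * w ^ 0 * ((4) * φ ^ 0)) * h

theorem mom_J4 (φ y z w : R) (h : φ ^ 2 = φ + 1) :
    (SJ.map (fun b => lin3 φ y z w b ^ 4)).sum = (12 + (12) * φ) * qq y z w ^ 2 := by
  simp only [SJ, List.map_cons, List.map_nil, List.sum_cons, List.sum_nil, lin3, ez,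
    qq]
  push_cast
  linear_combination (y ^ 0 * z ^ 0 * w ^ 4 * ((4) * φ ^ 2 + (4) * φ ^ 1 + (8) * φ ^ 0) +
    y ^ 0 * z ^ 2 * w ^ 2 * ((24) * φ ^ 0) +
    y ^ 0 * z ^ 4 * w ^ 0 * ((4) * φ ^ 2 + (4) * φ ^ 1 + (8) * φ ^ 0) +
    y ^ 2 * z ^ 0 * w ^ 2 * ((24) * φ ^ 0) +
    y ^ 2 * z ^ 2 * w ^ 0 * ((24) * φ ^ 0) +
    y ^ 4 * z ^ 0 * w ^ 0 * ((4) * φ ^ 2 + (4) * φ ^ 1 + (8) * φ ^ 0)) * h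

theorem mom_J6 (φ y z w : R) (h : φ ^ 2 = φ + 1) :
    (SJ.map (fun b => lin3 φ y z w b ^ 6)).sum = (24 + (32) * φ) * qq y z w ^ 3 + (-36 + (-48) * φ) * qq y z w ^ 0 * gg φ y z w := by
  simp only [SJ, List.map_cons, List.map_nil, List.sum_cons, List.sum_nil, lin3, ez,
    qq, gg]
  push_cast
  linear_combination (y ^ 0 * z ^ 0 * w ^ 6 * ((4) * φ ^ 4 + (4) * φ ^ 3 + (8) * φ ^ 2 + (12) * φ ^ 1 + (20) * φ ^ 0) +
    y ^ 0 * z ^ 2 * w ^ 4 * ((108) * φ ^ 0) +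
    y ^ 0 * z ^ 4 * w ^ 2 * ((60) * φ ^ 2 + (60) * φ ^ 1 + (72) * φ ^ 0) +
    y ^ 0 * z ^ 6 * w ^ 0 * ((4) * φ ^ 4 + (4) * φ ^ 3 + (8) * φ ^ 2 + (12) * φ ^ 1 + (20) * φ ^ 0) +
    y ^ 2 * z ^ 0 * w ^ 4 * ((60) * φ ^ 2 + (60) * φ ^ 1 + (72) * φ ^ 0) +
    y ^ 2 * z ^ 4 * w ^ 0 * ((108) * φ ^ 0) +
    y ^ 4 * z ^ 0 * w ^ 2 * ((108) * φ ^ 0) +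
    y ^ 4 * z ^ 2 * w ^ 0 * ((60) * φ ^ 2 + (60) * φ ^ 1 + (72) * φ ^ 0) +
    y ^ 6 * z ^ 0 * w ^ 0 * ((4) * φ ^ 4 + (4) * φ ^ 3 + (8) * φ ^ 2 + (12) * φ ^ 1 + (20) * φ ^ 0)) * h

theorem mom_J8 (φ y z w : R) (h : φ ^ 2 = φ + 1) :
    (SJ.map (fun b => lin3 φ y z w b ^ 8)).sum = (56 + (84) * φ) * qq y z w ^ 4 + (-224 + (-336) * φ) * qq y z w ^ 1 * gg φ y z w := by
  simp only [SJ, List.map_cons, List.map_nil, List.sum_cons, List.sum_nil, lin3, ez,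
    qq, gg]
  push_cast
  linear_combination (y ^ 0 * z ^ 0 * w ^ 8 * ((4) * φ ^ 6 + (4) * φ ^ 5 + (8) * φ ^ 4 + (12) * φ ^ 3 + (20) * φ ^ 2 + (32) * φ ^ 1 + (52) * φ ^ 0) +
    y ^ 0 * z ^ 2 * w ^ 6 * ((448) * φ ^ 0) +
    y ^ 0 * z ^ 4 * w ^ 4 * ((280) * φ ^ 2 + (280) * φ ^ 1 + (560) * φ ^ 0) +
    y ^ 0 * z ^ 6 * w ^ 2 * ((112) * φ ^ 4 + (112) * φ ^ 3 + (224) * φ ^ 2 + (336) * φ ^ 1 + (224) * φ ^ 0) +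
    y ^ 0 * z ^ 8 * w ^ 0 * ((4) * φ ^ 6 + (4) * φ ^ 5 + (8) * φ ^ 4 + (12) * φ ^ 3 + (20) * φ ^ 2 + (32) * φ ^ 1 + (52) * φ ^ 0) +
    y ^ 2 * z ^ 0 * w ^ 6 * ((112) * φ ^ 4 + (112) * φ ^ 3 + (224) * φ ^ 2 + (336) * φ ^ 1 + (224) * φ ^ 0) +
    y ^ 2 * z ^ 6 * w ^ 0 * ((448) * φ ^ 0) +
    y ^ 4 * z ^ 0 * w ^ 4 * ((280) * φ ^ 2 + (280) * φ ^ 1 + (560) * φ ^ 0) +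
    y ^ 4 * z ^ 4 * w ^ 0 * ((280) * φ ^ 2 + (280) * φ ^ 1 + (560) * φ ^ 0) +
    y ^ 6 * z ^ 0 * w ^ 2 * ((448) * φ ^ 0) +
    y ^ 6 * z ^ 2 * w ^ 0 * ((112) * φ ^ 4 + (112) * φ ^ 3 + (224) * φ ^ 2 + (336) * φ ^ 1 + (224) * φ ^ 0) +
    y ^ 8 * z ^ 0 * w ^ 0 * ((4) * φ ^ 6 + (4) * φ ^ 5 + (8) * φ ^ 4 + (12) * φ ^ 3 + (20) * φ ^ 2 + (32) * φ ^ 1 + (52) * φ ^ 0)) * h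

theorem ps_12 (φ x y z w : R) (h : φ ^ 2 = φ + 1)
    (h0 : ∀ b, lin3 φ y z w b ^ 10 = 0) (q g : R) (hq : qq y z w = q) (hg : gg φ y z w = g) :
    ps 12 φ x y z w = (15960) * x ^ 12 * q ^ 0 * g ^ 0 + (92400) * x ^ 10 * q ^ 1 * g ^ 0 + (249480) * x ^ 8 * q ^ 2 * g ^ 0 + (295680) * x ^ 6 * q ^ 3 * g ^ 0 + (-110880) * x ^ 6 * q ^ 0 * g ^ 1 + (249480) * x ^ 4 * q ^ 4 * g ^ 0 + (110880) * x ^ 4 * q ^ 1 * g ^ 1 := by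
  have hE : (SE.map (fun b => ell φ x y z w ((0, 0), b) ^ 12)).sum = 0 := by
    have : ∀ b, ell φ x y z w ((0, 0), b) ^ 12 = 0 := by
      intro b
      have : ell φ x y z w ((0, 0), b) = lin3 φ y z w b := by simp [ell, ez]
      rw [this, pow_eq_zero_of_le (by norm_num) (h0 b)]
    simp [this]
  obtain ⟨ψ, hψ⟩ : ∃ ψ, ψ = φ - 1 := ⟨_, rfl⟩
  have h' : (-ψ) ^ 2 = -ψ + 1 := by rw [hψ]; linear_combination h
  have hI4 : φ ^ 4 = 3 * φ + 2 := by
    have := phi_pow φ h 3; norm_num [Nat.fib_add_two] at this; exact this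
  have hJ4 : ψ ^ 4 = -3 * φ + 5 := by
    have := phi_pow (-ψ) h' 3; norm_num [Nat.fib_add_two] at this
    rw [hψ] at this ⊢; linear_combination this
  have hI6 : φ ^ 6 = 8 * φ + 5 := by
    have := phi_pow φ h 5; norm_num [Nat.fib_add_two] at this; exact this
  have hJ6 : ψ ^ 6 = -8 * φ + 13 := by
    have := phi_pow (-ψ) h' 5; norm_num [Nat.fib_add_two] at this
    rw [hψ] at this ⊢; linear_combination this
  have hI8 : φ ^ 8 = 21 * φ + 13 := by
    have := phi_pow φ h 7; norm_num [Nat.fib_add_two] at this; exact this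
  have hJ8 : ψ ^ 8 = -21 * φ + 34 := by
    have := phi_pow (-ψ) h' 7; norm_num [Nat.fib_add_two] at this
    rw [hψ] at this ⊢; linear_combination this
  have hI10 : φ ^ 10 = 55 * φ + 34 := by
    have := phi_pow φ h 9; norm_num [Nat.fib_add_two] at this; exact this
  have hJ10 : ψ ^ 10 = -55 * φ + 89 := by
    have := phi_pow (-ψ) h' 9; norm_num [Nat.fib_add_two] at this
    rw [hψ] at this ⊢; linear_combination this
  have hI12 : φ ^ 12 = 144 * φ + 89 := by
    have := phi_pow φ h 11; norm_num [Nat.fib_add_two] at this; exact this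
  have hJ12 : ψ ^ 12 = -144 * φ + 233 := by
    have := phi_pow (-ψ) h' 11; norm_num [Nat.fib_add_two] at this
    rw [hψ] at this ⊢; linear_combination this
  have e1 := shell_12 SI (lin3 φ y z w) h0 (φ * x)
  have e2 := shell_12 SD (lin3 φ y z w) h0 x
  have e3 := shell_12 SJ (lin3 φ y z w) h0 (ψ * x)
  rw [mom_I0 φ y z w h, mom_I2 φ y z w h, mom_I4 φ y z w h, mom_I6 φ y z w h,
    mom_I8 φ y z w h, hq, hg] at e1
  rw [mom_D0 φ y z w h, mom_D2 φ y z w h, mom_D4 φ y z w h, mom_D6 φ y z w h,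
    mom_D8 φ y z w h, hq, hg] at e2
  rw [mom_J0 φ y z w h, mom_J2 φ y z w h, mom_J4 φ y z w h, mom_J6 φ y z w h,
    mom_J8 φ y z w h, hq, hg] at e3
  have t1 : ∀ b, ell φ x y z w ((0, 1), b) = φ * x + lin3 φ y z w b := by
    intro b; simp [ell, ez]
  have t2 : ∀ b, ell φ x y z w ((0, -1), b) = -(φ * x) + lin3 φ y z w b := by
    intro b; simp [ell, ez]
  have t3 : ∀ b, ell φ x y z w ((1, 0), b) = x + lin3 φ y z w b := by
    intro b; simp [ell, ez]
  have t4 : ∀ b, ell φ x y z w ((-1, 0), b) = -x + lin3 φ y z w b := by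
    intro b; simp [ell, ez]
  have t5 : ∀ b, ell φ x y z w ((-1, 1), b) = ψ * x + lin3 φ y z w b := by
    intro b; simp [ell, ez, hψ]; ring
  have t6 : ∀ b, ell φ x y z w ((1, -1), b) = -(ψ * x) + lin3 φ y z w b := by
    intro b; simp [ell, ez, hψ]; ring
  have t7 : ell φ x y z w ((2, 0), (0, 0), (0, 0), (0, 0)) = 2 * x := by
    simp [ell, ez, lin3]
  have t8 : ell φ x y z w ((-2, 0), (0, 0), (0, 0), (0, 0)) = -(2 * x) := by
    simp [ell, ez, lin3]
  simp only [ps, pts, List.map_cons, List.sum_cons, List.map_append, List.sum_append,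
    List.map_map, Function.comp_def, hE]
  simp only [t1, t2, t3, t4, t5, t6, t7, t8]
  linear_combination e1 + e2 + e3 +
    (2 * x ^ 12 * (((12)) * q ^ 0) * hI12 + 
    132 * x ^ 10 * (((12 + (-4) * φ)) * q ^ 1) * hI10 + 
    990 * x ^ 8 * (((24 + (-12) * φ)) * q ^ 2) * hI8 + 
    1848 * x ^ 6 * (((56 + (-32) * φ)) * q ^ 3 + ((-84 + (48) * φ)) * q ^ 0 * g) * hI6 + 
    990 * x ^ 4 * (((140 + (-84) * φ)) * q ^ 4 + ((-560 + (336) * φ)) * q ^ 1 * g) * hI4 + 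
    2 * x ^ 12 * (((12)) * q ^ 0) * hJ12 + 
    132 * x ^ 10 * (((8 + (4) * φ)) * q ^ 1) * hJ10 + 
    990 * x ^ 8 * (((12 + (12) * φ)) * q ^ 2) * hJ8 + 
    1848 * x ^ 6 * (((24 + (32) * φ)) * q ^ 3 + ((-36 + (-48) * φ)) * q ^ 0 * g) * hJ6 + 
    990 * x ^ 4 * (((56 + (84) * φ)) * q ^ 4 + ((-224 + (-336) * φ)) * q ^ 1 * g) * hJ4) +
    (288 * x ^ 12 * ((0) * q ^ 0) + 
    7260 * x ^ 10 * ((-4) * q ^ 1) + 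
    20790 * x ^ 8 * ((-12) * q ^ 2) + 
    14784 * x ^ 6 * ((-32) * q ^ 3 + (48) * q ^ 0 * g) + 
    2970 * x ^ 4 * ((-84) * q ^ 4 + (336) * q ^ 1 * g) + 
    -288 * x ^ 12 * ((0) * q ^ 0) + 
    -7260 * x ^ 10 * ((4) * q ^ 1) + 
    -20790 * x ^ 8 * ((12) * q ^ 2) + 
    -14784 * x ^ 6 * ((32) * q ^ 3 + (-48) * q ^ 0 * g) + 
    -2970 * x ^ 4 * ((84) * q ^ 4 + (-336) * q ^ 1 * g)) * h

theorem ps_20 (φ x y z w : R) (h : φ ^ 2 = φ + 1)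
    (h0 : ∀ b, lin3 φ y z w b ^ 10 = 0) (q g : R) (hq : qq y z w = q) (hg : gg φ y z w = g) :
    ps 20 φ x y z w = (2460240) * x ^ 20 * q ^ 0 * g ^ 0 + (12144800) * x ^ 18 * q ^ 1 * g ^ 0 + (98372880) * x ^ 16 * q ^ 2 * g ^ 0 + (282172800) * x ^ 14 * q ^ 3 * g ^ 0 + (-409305600) * x ^ 14 * q ^ 0 * g ^ 1 + (380933280) * x ^ 12 * q ^ 4 * g ^ 0 + (-1241560320) * x ^ 12 * q ^ 1 * g ^ 1 := by
  have hE : (SE.map (fun b => ell φ x y z w ((0, 0), b) ^ 20)).sum = 0 := by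
    have : ∀ b, ell φ x y z w ((0, 0), b) ^ 20 = 0 := by
      intro b
      have : ell φ x y z w ((0, 0), b) = lin3 φ y z w b := by simp [ell, ez]
      rw [this, pow_eq_zero_of_le (by norm_num) (h0 b)]
    simp [this]
  obtain ⟨ψ, hψ⟩ : ∃ ψ, ψ = φ - 1 := ⟨_, rfl⟩
  have h' : (-ψ) ^ 2 = -ψ + 1 := by rw [hψ]; linear_combination h
  have hI12 : φ ^ 12 = 144 * φ + 89 := by
    have := phi_pow φ h 11; norm_num [Nat.fib_add_two] at this; exact this
  have hJ12 : ψ ^ 12 = -144 * φ + 233 := by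
    have := phi_pow (-ψ) h' 11; norm_num [Nat.fib_add_two] at this
    rw [hψ] at this ⊢; linear_combination this
  have hI14 : φ ^ 14 = 377 * φ + 233 := by
    have := phi_pow φ h 13; norm_num [Nat.fib_add_two] at this; exact this
  have hJ14 : ψ ^ 14 = -377 * φ + 610 := by
    have := phi_pow (-ψ) h' 13; norm_num [Nat.fib_add_two] at this
    rw [hψ] at this ⊢; linear_combination this
  have hI16 : φ ^ 16 = 987 * φ + 610 := by
    have := phi_pow φ h 15; norm_num [Nat.fib_add_two] at this; exact this
  have hJ16 : ψ ^ 16 = -987 * φ + 1597 := by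
    have := phi_pow (-ψ) h' 15; norm_num [Nat.fib_add_two] at this
    rw [hψ] at this ⊢; linear_combination this
  have hI18 : φ ^ 18 = 2584 * φ + 1597 := by
    have := phi_pow φ h 17; norm_num [Nat.fib_add_two] at this; exact this
  have hJ18 : ψ ^ 18 = -2584 * φ + 4181 := by
    have := phi_pow (-ψ) h' 17; norm_num [Nat.fib_add_two] at this
    rw [hψ] at this ⊢; linear_combination this
  have hI20 : φ ^ 20 = 6765 * φ + 4181 := by
    have := phi_pow φ h 19; norm_num [Nat.fib_add_two] at this; exact this
  have hJ20 : ψ ^ 20 = -6765 * φ + 10946 := by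
    have := phi_pow (-ψ) h' 19; norm_num [Nat.fib_add_two] at this
    rw [hψ] at this ⊢; linear_combination this
  have e1 := shell_20 SI (lin3 φ y z w) h0 (φ * x)
  have e2 := shell_20 SD (lin3 φ y z w) h0 x
  have e3 := shell_20 SJ (lin3 φ y z w) h0 (ψ * x)
  rw [mom_I0 φ y z w h, mom_I2 φ y z w h, mom_I4 φ y z w h, mom_I6 φ y z w h,
    mom_I8 φ y z w h, hq, hg] at e1
  rw [mom_D0 φ y z w h, mom_D2 φ y z w h, mom_D4 φ y z w h, mom_D6 φ y z w h,
    mom_D8 φ y z w h, hq, hg] at e2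
  rw [mom_J0 φ y z w h, mom_J2 φ y z w h, mom_J4 φ y z w h, mom_J6 φ y z w h,
    mom_J8 φ y z w h, hq, hg] at e3
  have t1 : ∀ b, ell φ x y z w ((0, 1), b) = φ * x + lin3 φ y z w b := by
    intro b; simp [ell, ez]
  have t2 : ∀ b, ell φ x y z w ((0, -1), b) = -(φ * x) + lin3 φ y z w b := by
    intro b; simp [ell, ez]
  have t3 : ∀ b, ell φ x y z w ((1, 0), b) = x + lin3 φ y z w b := by
    intro b; simp [ell, ez]
  have t4 : ∀ b, ell φ x y z w ((-1, 0), b) = -x + lin3 φ y z w b := by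
    intro b; simp [ell, ez]
  have t5 : ∀ b, ell φ x y z w ((-1, 1), b) = ψ * x + lin3 φ y z w b := by
    intro b; simp [ell, ez, hψ]; ring
  have t6 : ∀ b, ell φ x y z w ((1, -1), b) = -(ψ * x) + lin3 φ y z w b := by
    intro b; simp [ell, ez, hψ]; ring
  have t7 : ell φ x y z w ((2, 0), (0, 0), (0, 0), (0, 0)) = 2 * x := by
    simp [ell, ez, lin3]
  have t8 : ell φ x y z w ((-2, 0), (0, 0), (0, 0), (0, 0)) = -(2 * x) := by
    simp [ell, ez, lin3]
  simp only [ps, pts, List.map_cons, List.sum_cons, List.map_append, List.sum_append,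
    List.map_map, Function.comp_def, hE]
  simp only [t1, t2, t3, t4, t5, t6, t7, t8]
  linear_combination e1 + e2 + e3 +
    (2 * x ^ 20 * (((12)) * q ^ 0) * hI20 + 
    380 * x ^ 18 * (((12 + (-4) * φ)) * q ^ 1) * hI18 + 
    9690 * x ^ 16 * (((24 + (-12) * φ)) * q ^ 2) * hI16 + 
    77520 * x ^ 14 * (((56 + (-32) * φ)) * q ^ 3 + ((-84 + (48) * φ)) * q ^ 0 * g) * hI14 + 
    251940 * x ^ 12 * (((140 + (-84) * φ)) * q ^ 4 + ((-560 + (336) * φ)) * q ^ 1 * g) * hI12 + 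
    2 * x ^ 20 * (((12)) * q ^ 0) * hJ20 + 
    380 * x ^ 18 * (((8 + (4) * φ)) * q ^ 1) * hJ18 + 
    9690 * x ^ 16 * (((12 + (12) * φ)) * q ^ 2) * hJ16 + 
    77520 * x ^ 14 * (((24 + (32) * φ)) * q ^ 3 + ((-36 + (-48) * φ)) * q ^ 0 * g) * hJ14 + 
    251940 * x ^ 12 * (((56 + (84) * φ)) * q ^ 4 + ((-224 + (-336) * φ)) * q ^ 1 * g) * hJ12) +
    (13530 * x ^ 20 * ((0) * q ^ 0) + 
    981920 * x ^ 18 * ((-4) * q ^ 1) + 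
    9564030 * x ^ 16 * ((-12) * q ^ 2) + 
    29225040 * x ^ 14 * ((-32) * q ^ 3 + (48) * q ^ 0 * g) + 
    36279360 * x ^ 12 * ((-84) * q ^ 4 + (336) * q ^ 1 * g) + 
    -13530 * x ^ 20 * ((0) * q ^ 0) + 
    -981920 * x ^ 18 * ((4) * q ^ 1) + 
    -9564030 * x ^ 16 * ((12) * q ^ 2) + 
    -29225040 * x ^ 14 * ((32) * q ^ 3 + (-48) * q ^ 0 * g) + 
    -36279360 * x ^ 12 * ((84) * q ^ 4 + (-336) * q ^ 1 * g)) * h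

theorem ps_30 (φ x y z w : R) (h : φ ^ 2 = φ + 1)
    (h0 : ∀ b, lin3 φ y z w b ^ 10 = 0) (q g : R) (hq : qq y z w = q) (hg : gg φ y z w = g) :
    ps 30 φ x y z w = (2192135640) * x ^ 30 * q ^ 0 * g ^ 0 + (3417690600) * x ^ 28 * q ^ 1 * g ^ 0 + (68195698200) * x ^ 26 * q ^ 2 * g ^ 0 + (520051896000) * x ^ 24 * q ^ 3 * g ^ 0 + (-779864085000) * x ^ 24 * q ^ 0 * g ^ 1 + (1896113583000) * x ^ 22 * q ^ 4 * g ^ 0 + (-7571343780000) * x ^ 22 * q ^ 1 * g ^ 1 := by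
  have hE : (SE.map (fun b => ell φ x y z w ((0, 0), b) ^ 30)).sum = 0 := by
    have : ∀ b, ell φ x y z w ((0, 0), b) ^ 30 = 0 := by
      intro b
      have : ell φ x y z w ((0, 0), b) = lin3 φ y z w b := by simp [ell, ez]
      rw [this, pow_eq_zero_of_le (by norm_num) (h0 b)]
    simp [this]
  obtain ⟨ψ, hψ⟩ : ∃ ψ, ψ = φ - 1 := ⟨_, rfl⟩
  have h' : (-ψ) ^ 2 = -ψ + 1 := by rw [hψ]; linear_combination h
  have hI22 : φ ^ 22 = 17711 * φ + 10946 := by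
    have := phi_pow φ h 21; norm_num [Nat.fib_add_two] at this; exact this
  have hJ22 : ψ ^ 22 = -17711 * φ + 28657 := by
    have := phi_pow (-ψ) h' 21; norm_num [Nat.fib_add_two] at this
    rw [hψ] at this ⊢; linear_combination this
  have hI24 : φ ^ 24 = 46368 * φ + 28657 := by
    have := phi_pow φ h 23; norm_num [Nat.fib_add_two] at this; exact this
  have hJ24 : ψ ^ 24 = -46368 * φ + 75025 := by
    have := phi_pow (-ψ) h' 23; norm_num [Nat.fib_add_two] at this
    rw [hψ] at this ⊢; linear_combination this
  have hI26 : φ ^ 26 = 121393 * φ + 75025 := by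
    have := phi_pow φ h 25; norm_num [Nat.fib_add_two] at this; exact this
  have hJ26 : ψ ^ 26 = -121393 * φ + 196418 := by
    have := phi_pow (-ψ) h' 25; norm_num [Nat.fib_add_two] at this
    rw [hψ] at this ⊢; linear_combination this
  have hI28 : φ ^ 28 = 317811 * φ + 196418 := by
    have := phi_pow φ h 27; norm_num [Nat.fib_add_two] at this; exact this
  have hJ28 : ψ ^ 28 = -317811 * φ + 514229 := by
    have := phi_pow (-ψ) h' 27; norm_num [Nat.fib_add_two] at this
    rw [hψ] at this ⊢; linear_combination this
  have hI30 : φ ^ 30 = 832040 * φ + 514229 := by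
    have := phi_pow φ h 29; norm_num [Nat.fib_add_two] at this; exact this
  have hJ30 : ψ ^ 30 = -832040 * φ + 1346269 := by
    have := phi_pow (-ψ) h' 29; norm_num [Nat.fib_add_two] at this
    rw [hψ] at this ⊢; linear_combination this
  have e1 := shell_30 SI (lin3 φ y z w) h0 (φ * x)
  have e2 := shell_30 SD (lin3 φ y z w) h0 x
  have e3 := shell_30 SJ (lin3 φ y z w) h0 (ψ * x)
  rw [mom_I0 φ y z w h, mom_I2 φ y z w h, mom_I4 φ y z w h, mom_I6 φ y z w h,
    mom_I8 φ y z w h, hq, hg] at e1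
  rw [mom_D0 φ y z w h, mom_D2 φ y z w h, mom_D4 φ y z w h, mom_D6 φ y z w h,
    mom_D8 φ y z w h, hq, hg] at e2
  rw [mom_J0 φ y z w h, mom_J2 φ y z w h, mom_J4 φ y z w h, mom_J6 φ y z w h,
    mom_J8 φ y z w h, hq, hg] at e3
  have t1 : ∀ b, ell φ x y z w ((0, 1), b) = φ * x + lin3 φ y z w b := by
    intro b; simp [ell, ez]
  have t2 : ∀ b, ell φ x y z w ((0, -1), b) = -(φ * x) + lin3 φ y z w b := by
    intro b; simp [ell, ez]
  have t3 : ∀ b, ell φ x y z w ((1, 0), b) = x + lin3 φ y z w b := by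
    intro b; simp [ell, ez]
  have t4 : ∀ b, ell φ x y z w ((-1, 0), b) = -x + lin3 φ y z w b := by
    intro b; simp [ell, ez]
  have t5 : ∀ b, ell φ x y z w ((-1, 1), b) = ψ * x + lin3 φ y z w b := by
    intro b; simp [ell, ez, hψ]; ring
  have t6 : ∀ b, ell φ x y z w ((1, -1), b) = -(ψ * x) + lin3 φ y z w b := by
    intro b; simp [ell, ez, hψ]; ring
  have t7 : ell φ x y z w ((2, 0), (0, 0), (0, 0), (0, 0)) = 2 * x := by
    simp [ell, ez, lin3]
  have t8 : ell φ x y z w ((-2, 0), (0, 0), (0, 0), (0, 0)) = -(2 * x) := by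
    simp [ell, ez, lin3]
  simp only [ps, pts, List.map_cons, List.sum_cons, List.map_append, List.sum_append,
    List.map_map, Function.comp_def, hE]
  simp only [t1, t2, t3, t4, t5, t6, t7, t8]
  linear_combination e1 + e2 + e3 +
    (2 * x ^ 30 * (((12)) * q ^ 0) * hI30 + 
    870 * x ^ 28 * (((12 + (-4) * φ)) * q ^ 1) * hI28 + 
    54810 * x ^ 26 * (((24 + (-12) * φ)) * q ^ 2) * hI26 + 
    1187550 * x ^ 24 * (((56 + (-32) * φ)) * q ^ 3 + ((-84 + (48) * φ)) * q ^ 0 * g) * hI24 + 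
    11705850 * x ^ 22 * (((140 + (-84) * φ)) * q ^ 4 + ((-560 + (336) * φ)) * q ^ 1 * g) * hI22 + 
    2 * x ^ 30 * (((12)) * q ^ 0) * hJ30 + 
    870 * x ^ 28 * (((8 + (4) * φ)) * q ^ 1) * hJ28 + 
    54810 * x ^ 26 * (((12 + (12) * φ)) * q ^ 2) * hJ26 + 
    1187550 * x ^ 24 * (((24 + (32) * φ)) * q ^ 3 + ((-36 + (-48) * φ)) * q ^ 0 * g) * hJ24 + 
    11705850 * x ^ 22 * (((56 + (84) * φ)) * q ^ 4 + ((-224 + (-336) * φ)) * q ^ 1 * g) * hJ22) +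
    (1664080 * x ^ 30 * ((0) * q ^ 0) + 
    276495570 * x ^ 28 * ((-4) * q ^ 1) + 
    6653550330 * x ^ 26 * ((-12) * q ^ 2) + 
    55064318400 * x ^ 24 * ((-32) * q ^ 3 + (48) * q ^ 0 * g) + 
    207322309350 * x ^ 22 * ((-84) * q ^ 4 + (336) * q ^ 1 * g) + 
    -1664080 * x ^ 30 * ((0) * q ^ 0) + 
    -276495570 * x ^ 28 * ((4) * q ^ 1) + 
    -6653550330 * x ^ 26 * ((12) * q ^ 2) + 
    -55064318400 * x ^ 24 * ((32) * q ^ 3 + (-48) * q ^ 0 * g) + 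
    -207322309350 * x ^ 22 * ((84) * q ^ 4 + (-336) * q ^ 1 * g)) * h

theorem comb36_local (x q g : R) (h1 : q ^ 5 = 0) (h2 : q ^ 2 * g = 0) (h3 : g ^ 2 = 0) :
    comb36 (x ^ 2 + q) ((15960) * x ^ 12 * q ^ 0 * g ^ 0 + (92400) * x ^ 10 * q ^ 1 * g ^ 0 + (249480) * x ^ 8 * q ^ 2 * g ^ 0 + (295680) * x ^ 6 * q ^ 3 * g ^ 0 + (-110880) * x ^ 6 * q ^ 0 * g ^ 1 + (249480) * x ^ 4 * q ^ 4 * g ^ 0 + (110880) * x ^ 4 * q ^ 1 * g ^ 1)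
      ((2460240) * x ^ 20 * q ^ 0 * g ^ 0 + (12144800) * x ^ 18 * q ^ 1 * g ^ 0 + (98372880) * x ^ 16 * q ^ 2 * g ^ 0 + (282172800) * x ^ 14 * q ^ 3 * g ^ 0 + (-409305600) * x ^ 14 * q ^ 0 * g ^ 1 + (380933280) * x ^ 12 * q ^ 4 * g ^ 0 + (-1241560320) * x ^ 12 * q ^ 1 * g ^ 1)
      ((2192135640) * x ^ 30 * q ^ 0 * g ^ 0 + (3417690600) * x ^ 28 * q ^ 1 * g ^ 0 + (68195698200) * x ^ 26 * q ^ 2 * g ^ 0 + (520051896000) * x ^ 24 * q ^ 3 * g ^ 0 + (-779864085000) * x ^ 24 * q ^ 0 * g ^ 1 + (1896113583000) * x ^ 22 * q ^ 4 * g ^ 0 + (-7571343780000) * x ^ 22 * q ^ 1 * g ^ 1) = 0 := by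
  simp only [comb36]
  push_cast
  linear_combination ((30624687559065600) * x ^ 26 * q ^ 0 * g ^ 0 +
    (-19836997579741934592000) * x ^ 20 * q ^ 0 * g ^ 1 +
    (27333156099465216000) * x ^ 14 * q ^ 0 * g ^ 2 +
    (-1821161874179699251200) * x ^ 24 * q ^ 1 * g ^ 0 +
    (57132305564749519104000) * x ^ 18 * q ^ 1 * g ^ 1 +
    (-23190731390002176000) * x ^ 12 * q ^ 1 * g ^ 2 +
    (-19314873510766677043200) * x ^ 22 * q ^ 2 * g ^ 0 +
    (187098904328395707648000) * x ^ 16 * q ^ 2 * g ^ 1 +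
    (-45559824821102592000) * x ^ 10 * q ^ 2 * g ^ 2 +
    (-90737702555642901158400) * x ^ 20 * q ^ 3 * g ^ 0 +
    (266804439327005868288000) * x ^ 14 * q ^ 3 * g ^ 1 +
    (-11389956205275648000) * x ^ 8 * q ^ 3 * g ^ 2 +
    (-253002392037929229696000) * x ^ 18 * q ^ 4 * g ^ 0 +
    (230153130707345733888000) * x ^ 12 * q ^ 4 * g ^ 1 +
    (-469752551934785966246400) * x ^ 16 * q ^ 5 * g ^ 0 +
    (127574727930905359104000) * x ^ 10 * q ^ 5 * g ^ 1 +
    (-614129921206732303027200) * x ^ 14 * q ^ 6 * g ^ 0 +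
    (44793903719449108224000) * x ^ 8 * q ^ 6 * g ^ 1 +
    (-580427952286992615187200) * x ^ 12 * q ^ 7 * g ^ 0 +
    (9135124884187061760000) * x ^ 6 * q ^ 7 * g ^ 1 +
    (-399367491626337761318400) * x ^ 10 * q ^ 8 * g ^ 0 +
    (830465898562460160000) * x ^ 4 * q ^ 8 * g ^ 1 +
    (-198019338099644297376000) * x ^ 8 * q ^ 9 * g ^ 0 +
    (-68623996851618930892800) * x ^ 6 * q ^ 10 * g ^ 0 +
    (-15617917698666698822400) * x ^ 4 * q ^ 11 * g ^ 0 +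
    (-2057231290639086374400) * x ^ 2 * q ^ 12 * g ^ 0 +
    (-114290627257727020800) * x ^ 0 * q ^ 13 * g ^ 0) * h1 +
    ((-1137394982640204288000) * x ^ 26 * q ^ 0 * g ^ 0 +
    (-101814637073909760000) * x ^ 20 * q ^ 0 * g ^ 1 +
    (-9941819302711296000) * x ^ 14 * q ^ 0 * g ^ 2 +
    (-9150861118459027968000) * x ^ 24 * q ^ 1 * g ^ 0 +
    (161547716686067712000) * x ^ 18 * q ^ 1 * g ^ 1 +
    (3313939767570432000) * x ^ 12 * q ^ 1 * g ^ 2 +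
    (-25646676445184610816000) * x ^ 22 * q ^ 2 * g ^ 0 +
    (200322181363239936000) * x ^ 16 * q ^ 2 * g ^ 1) * h2 +
    ((-41181179198455296000) * x ^ 24 * q ^ 0 * g ^ 0 +
    (-3313939767570432000) * x ^ 18 * q ^ 0 * g ^ 1 +
    (-166066725460027392000) * x ^ 22 * q ^ 1 * g ^ 0 +
    (9941819302711296000) * x ^ 16 * q ^ 1 * g ^ 1) * h3

end Ring

/-! ### Invariance under left multiplication by icosians -/

section Inv
variable {R : Type*} [CommRing R]

theorem sq4_qmul (t : R) (a b c d x y z w : R)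
    (hn : t ^ 2 * (a ^ 2 + b ^ 2 + c ^ 2 + d ^ 2) = 1) :
    sq4 (t * (a * x + b * y + c * z + d * w)) (t * (-b * x + a * y + d * z - c * w))
      (t * (-c * x - d * y + a * z + b * w)) (t * (-d * x + c * y - b * z + a * w))
    = sq4 x y z w := by
  simp only [sq4]
  linear_combination (x ^ 2 + y ^ 2 + z ^ 2 + w ^ 2) * hn

theorem ell_qmul (φ : R) (h : φ ^ 2 = φ + 1) (t x y z w : R) (G P : Pt) :
    ell φ (t * (ez φ G.1 * x + ez φ G.2.1 * y + ez φ G.2.2.1 * z + ez φ G.2.2.2 * w))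
      (t * (-ez φ G.2.1 * x + ez φ G.1 * y + ez φ G.2.2.2 * z - ez φ G.2.2.1 * w))
      (t * (-ez φ G.2.2.1 * x - ez φ G.2.2.2 * y + ez φ G.1 * z + ez φ G.2.1 * w))
      (t * (-ez φ G.2.2.2 * x + ez φ G.2.2.1 * y - ez φ G.2.1 * z + ez φ G.1 * w)) P
    = t * ell φ x y z w (qmul G P) := by
  simp only [ell, lin3, qmul, ez_add, ez_sub, ez_mul φ h]
  ring

theorem ell_psmul (φ x y z w : R) (k : ℤ) (P : Pt) :
    ell φ x y z w (psmul k P) = k * ell φ x y z w P := by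
  simp only [ell, lin3, psmul, ez]
  push_cast
  ring

theorem ps_qmul (n : ℕ) (φ : R) (h : φ ^ 2 = φ + 1) (t : R) (ht : t * 2 = 1) (x y z w : R) (G : Pt)
    (hG : (pts.map (qmul G)).Perm (pts.map (psmul 2))) :
    ps n φ (t * (ez φ G.1 * x + ez φ G.2.1 * y + ez φ G.2.2.1 * z + ez φ G.2.2.2 * w))
      (t * (-ez φ G.2.1 * x + ez φ G.1 * y + ez φ G.2.2.2 * z - ez φ G.2.2.1 * w))
      (t * (-ez φ G.2.2.1 * x - ez φ G.2.2.2 * y + ez φ G.1 * z + ez φ G.2.1 * w))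
      (t * (-ez φ G.2.2.2 * x + ez φ G.2.2.1 * y - ez φ G.2.1 * z + ez φ G.1 * w))
    = ps n φ x y z w := by
  simp only [ps, ell_qmul φ h]
  have := (hG.map (fun P => (t * ell φ x y z w P) ^ n)).sum_eq
  simp only [List.map_map, Function.comp_def] at this
  rw [this]
  congr 2
  funext P
  rw [ell_psmul]
  push_cast
  rw [← mul_assoc, ht, one_mul]

theorem F36_qmul (φ : R) (h : φ ^ 2 = φ + 1) (t : R) (ht : t * 2 = 1) (x y z w : R) (G : Pt)
    (hG : (pts.map (qmul G)).Perm (pts.map (psmul 2)))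
    (hn : ez φ G.1 ^ 2 + ez φ G.2.1 ^ 2 + ez φ G.2.2.1 ^ 2 + ez φ G.2.2.2 ^ 2 = 4) :
    F36 φ (t * (ez φ G.1 * x + ez φ G.2.1 * y + ez φ G.2.2.1 * z + ez φ G.2.2.2 * w))
      (t * (-ez φ G.2.1 * x + ez φ G.1 * y + ez φ G.2.2.2 * z - ez φ G.2.2.1 * w))
      (t * (-ez φ G.2.2.1 * x - ez φ G.2.2.2 * y + ez φ G.1 * z + ez φ G.2.1 * w))
      (t * (-ez φ G.2.2.2 * x + ez φ G.2.2.1 * y - ez φ G.2.1 * z + ez φ G.1 * w))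
    = F36 φ x y z w := by
  simp only [F36, ps_qmul _ φ h t ht x y z w G hG]
  rw [sq4_qmul t]
  rw [hn]
  linear_combination (t * 2 + 1) * ht

theorem F36_map {S : Type*} [CommRing S] (f : R →+* S) (φ x y z w : R) :
    f (F36 φ x y z w) = F36 (f φ) (f x) (f y) (f z) (f w) := by
  have hps : ∀ n, f (ps n φ x y z w) = ps n (f φ) (f x) (f y) (f z) (f w) := by
    intro n
    simp only [ps, map_list_sum, List.map_map, Function.comp_def, ell, lin3, ez, map_pow,
      map_add, map_mul, map_intCast]
  simp only [F36, comb36, sq4, map_add, map_mul, map_pow, map_intCast, hps]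

theorem F36_local (φ x y z w : R) (h : φ ^ 2 = φ + 1) (J : Ideal R) (hJ : J ^ 10 = ⊥)
    (hy : y ∈ J) (hz : z ∈ J) (hw : w ∈ J) : F36 φ x y z w = 0 := by
  have hlin : ∀ b, lin3 φ y z w b ∈ J := fun b =>
    J.add_mem (J.add_mem (J.mul_mem_left _ hy) (J.mul_mem_left _ hz)) (J.mul_mem_left _ hw)
  have h0 : ∀ b, lin3 φ y z w b ^ 10 = 0 := by
    intro b
    have := Ideal.pow_mem_pow (hlin b) 10
    rwa [hJ, Ideal.mem_bot] at this
  have y2 := Ideal.pow_mem_pow hy 2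
  have z2 := Ideal.pow_mem_pow hz 2
  have w2 := Ideal.pow_mem_pow hw 2
  have y4 := Ideal.pow_mem_pow hy 4
  have z4 := Ideal.pow_mem_pow hz 4
  have w4 := Ideal.pow_mem_pow hw 4
  have m42 : ∀ a b : R, a ∈ J ^ 4 → b ∈ J ^ 2 → a * b ∈ J ^ 6 := by
    intro a b ha hb
    have := Ideal.mul_mem_mul ha hb
    rwa [← pow_add] at this
  have m22 : ∀ a b : R, a ∈ J ^ 2 → b ∈ J ^ 2 → a * b ∈ J ^ 4 := by
    intro a b ha hb
    have := Ideal.mul_mem_mul ha hb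
    rwa [← pow_add] at this
  have hq : qq y z w ∈ J ^ 2 := Ideal.add_mem _ (Ideal.add_mem _ y2 z2) w2
  have hg : gg φ y z w ∈ J ^ 6 := by
    refine Ideal.add_mem _ (Ideal.sub_mem _ ?_ ?_) ?_
    · exact Ideal.mul_mem_left _ _ (m42 _ _ (m22 _ _ y2 z2) w2)
    · exact Ideal.mul_mem_left _ _ (Ideal.add_mem _ (Ideal.add_mem _ (m42 _ _ y4 z2)
        (m42 _ _ z4 w2)) (m42 _ _ w4 y2))
    · exact Ideal.mul_mem_left _ _ (Ideal.add_mem _ (Ideal.add_mem _ (m42 _ _ y4 w2)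
        (m42 _ _ z4 y2)) (m42 _ _ w4 z2))
  obtain ⟨q, hq'⟩ : ∃ q, qq y z w = q := ⟨_, rfl⟩
  obtain ⟨g, hg'⟩ : ∃ g, gg φ y z w = g := ⟨_, rfl⟩
  have h1 : q ^ 5 = 0 := by
    have := Ideal.pow_mem_pow hq 5
    rwa [← pow_mul, hJ, Ideal.mem_bot, hq'] at this
  have h2 : q ^ 2 * g = 0 := by
    have := Ideal.mul_mem_mul (Ideal.pow_mem_pow hq 2) hg
    rwa [← pow_mul, ← pow_add, hJ, Ideal.mem_bot, hq', hg'] at this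
  have h3 : g ^ 2 = 0 := by
    have := Ideal.pow_le_pow_right (show 10 ≤ 6 * 2 by norm_num)
      (pow_mul J 6 2 ▸ Ideal.pow_mem_pow hg 2)
    rwa [hJ, Ideal.mem_bot, hg'] at this
  have hs : sq4 x y z w = x ^ 2 + q := by rw [← hq']; simp only [sq4, qq]; ring
  rw [F36, ps_12 φ x y z w h h0 q g hq' hg', ps_20 φ x y z w h h0 q g hq' hg',
    ps_30 φ x y z w h h0 q g hq' hg', hs]
  exact comb36_local x q g h1 h2 h3

theorem F36_mem (φ x y z w : R) (h : φ ^ 2 = φ + 1) (J : Ideal R)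
    (hy : y ∈ J) (hz : z ∈ J) (hw : w ∈ J) : F36 φ x y z w ∈ J ^ 10 := by
  rw [← Ideal.Quotient.eq_zero_iff_mem, F36_map]
  refine F36_local _ _ _ _ _ ?_ (J.map (Ideal.Quotient.mk (J ^ 10))) ?_
    (Ideal.mem_map_of_mem _ hy) (Ideal.mem_map_of_mem _ hz) (Ideal.mem_map_of_mem _ hw)
  · rw [← map_pow, h, map_add, map_one]
  · rw [← Ideal.map_pow, Ideal.map_quotient_self]

end Inv

/-! ### The polynomial -/

noncomputable def FF : MvPolynomial (Fin 4) ℝ := F36 (C gr) (X 0) (X 1) (X 2) (X 3)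

theorem gr_sq : gr ^ 2 = gr + 1 := by
  have h : Real.sqrt 5 ^ 2 = 5 := Real.sq_sqrt (by norm_num)
  simp only [gr]
  linear_combination h / 4

theorem gr_inv : gr⁻¹ = gr - 1 := by
  have h : gr * (gr - 1) = 1 := by linear_combination gr_sq
  exact inv_eq_of_mul_eq_one_right h

/-- The ideal of polynomials vanishing at `v`. -/
noncomputable def IV (v : Fin 4 → ℝ) : Ideal (MvPolynomial (Fin 4) ℝ) := RingHom.ker (eval v)

theorem mem_IV (v : Fin 4 → ℝ) (p : MvPolynomial (Fin 4) ℝ) : p ∈ IV v ↔ eval v p = 0 :=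
  RingHom.mem_ker

theorem pderiv_mem (v : Fin 4 → ℝ) (i : Fin 4) (n : ℕ) (p : MvPolynomial (Fin 4) ℝ)
    (hp : p ∈ IV v ^ (n + 1)) : pderiv i p ∈ IV v ^ n := by
  induction n generalizing p with
  | zero => simp
  | succ n ih =>
    rw [pow_succ] at hp
    induction hp using Submodule.mul_induction_on' with
    | mem_mul_mem a ha b hb =>
      rw [Derivation.leibniz, smul_eq_mul, smul_eq_mul]
      refine Ideal.add_mem _ (Ideal.mul_mem_right _ _ ha) ?_
      rw [pow_succ, mul_comm b]
      exact Ideal.mul_mem_mul (ih a ha) hb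
    | add a _ b _ ha hb => rw [map_add]; exact Ideal.add_mem _ ha hb

theorem vanishes_of_mem (v : Fin 4 → ℝ) (m : ℕ) (p : MvPolynomial (Fin 4) ℝ)
    (hp : p ∈ IV v ^ m) : vanishesToOrderR p v m := by
  intro l
  induction l generalizing m p with
  | nil =>
    intro hl
    exact (mem_IV v p).1 (Ideal.pow_le_self (by simp at hl; omega) hp)
  | cons i l ih =>
    intro hl
    simp only [List.length_cons] at hl
    obtain ⟨k, rfl⟩ : ∃ k, m = k + 1 := ⟨m - 1, by omega⟩
    exact ih k _ (pderiv_mem v i k p hp) (by omega)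

/-- The real vector of a point. -/
noncomputable def vec (P : Pt) : Fin 4 → ℝ :=
  ![ez gr P.1, ez gr P.2.1, ez gr P.2.2.1, ez gr P.2.2.2]

def Good (P : Pt) : Prop := ∀ c : ℝ, FF ∈ IV (c • vec P) ^ 10

theorem good_base : Good ((2, 0), (0, 0), (0, 0), (0, 0)) := by
  intro c
  refine F36_mem _ _ _ _ _ ?_ _ ?_ ?_ ?_
  · rw [← map_pow, gr_sq, map_add, map_one]
  all_goals simp [mem_IV, vec, ez]

theorem ez_C (a : Zp) : ez (C gr : MvPolynomial (Fin 4) ℝ) a = C (ez gr a) := by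
  simp [ez]

theorem good_step (G : Pt) (hG : (pts.map (qmul G)).Perm (pts.map (psmul 2)))
    (hn : ez gr G.1 ^ 2 + ez gr G.2.1 ^ 2 + ez gr G.2.2.1 ^ 2 + ez gr G.2.2.2 ^ 2 = 4)
    (P : Pt) (hP : Good P) : Good (qmul G P) := by
  intro c
  let t : MvPolynomial (Fin 4) ℝ := C (1 / 2)
  let s : Fin 4 → MvPolynomial (Fin 4) ℝ := ![
    t * (C (ez gr G.1) * X 0 + C (ez gr G.2.1) * X 1 + C (ez gr G.2.2.1) * X 2
      + C (ez gr G.2.2.2) * X 3),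
    t * (-C (ez gr G.2.1) * X 0 + C (ez gr G.1) * X 1 + C (ez gr G.2.2.2) * X 2
      - C (ez gr G.2.2.1) * X 3),
    t * (-C (ez gr G.2.2.1) * X 0 - C (ez gr G.2.2.2) * X 1 + C (ez gr G.1) * X 2
      + C (ez gr G.2.1) * X 3),
    t * (-C (ez gr G.2.2.2) * X 0 + C (ez gr G.2.2.1) * X 1 - C (ez gr G.2.1) * X 2
      + C (ez gr G.1) * X 3)]
  let T : MvPolynomial (Fin 4) ℝ →+* MvPolynomial (Fin 4) ℝ := (aeval s).toRingHom
  have hφ : (C gr : MvPolynomial (Fin 4) ℝ) ^ 2 = C gr + 1 := by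
    rw [← map_pow, gr_sq, map_add, map_one]
  have ht : t * 2 = 1 := by
    have : (2 : MvPolynomial (Fin 4) ℝ) = C 2 := (map_ofNat C 2).symm
    rw [this, ← C_mul]; norm_num
  have hT : T FF = FF := by
    have e := F36_qmul (C gr) hφ t ht (X 0) (X 1) (X 2) (X 3) G hG (by
      simp only [ez_C, ← map_pow, ← map_add, hn]; exact map_ofNat C 4)
    simp only [ez_C] at e
    rw [FF, F36_map]
    have hX : ∀ i, T (X i) = s i := fun i => aeval_X s i
    have hC : T (C gr) = C gr := aeval_C s gr
    rw [hX, hX, hX, hX, hC]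
    exact e
  have hle : (IV ((2 * c) • vec P)).map T ≤ IV (c • vec (qmul G P)) := by
    rw [Ideal.map_le_iff_le_comap]
    intro p hp
    rw [Ideal.mem_comap, mem_IV]
    rw [mem_IV] at hp
    have : (eval (c • vec (qmul G P))).comp T = eval ((2 * c) • vec P) := by
      apply MvPolynomial.ringHom_ext
      · intro r
        simp [T]
      · intro i
        have hX : ∀ i, T (X i) = s i := fun i => aeval_X s i
        rw [RingHom.comp_apply, hX, eval_X]
        fin_cases i <;>
        · simp [s, t, vec, qmul, ez_add, ez_sub, ez_mul gr gr_sq]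
          first
          | linear_combination (c / 2 * ez gr P.1) * hn
          | linear_combination (c / 2 * ez gr P.2.1) * hn
          | linear_combination (c / 2 * ez gr P.2.2.1) * hn
          | linear_combination (c / 2 * ez gr P.2.2.2) * hn
    have h2 := congrArg (fun f => f p) this
    simp only [RingHom.comp_apply] at h2
    rw [h2, hp]
  have := Ideal.mem_map_of_mem T (hP (2 * c))
  rw [hT, Ideal.map_pow] at this
  exact Ideal.pow_right_mono hle 10 this

theorem good_iter (G : Pt) (h : ∀ P, Good P → Good (qmul G P)) (n : ℕ) (P : Pt) (hP : Good P) :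
    Good ((qmul G)^[n] P) := by
  induction n with
  | zero => exact hP
  | succ n ih => rw [Function.iterate_succ_apply']; exact h _ ih

theorem good_pts (P : Pt) (hP : P ∈ pts) : Good P := by
  obtain ⟨t, k, ht⟩ := exists_word P hP
  have hA := good_step gA perm_A (by simp [gA, ez]; linear_combination 2 * gr_sq)
  have hW := good_step gW perm_W (by simp [gW, ez]; norm_num)
  have hI := good_step gI perm_I (by simp [gI, ez]; norm_num)
  have hJ := good_step gJ perm_J (by simp [gJ, ez]; norm_num)
  have hw : Good (word t) :=
    good_iter _ hA _ _ (good_iter _ hW _ _ (good_iter _ hI _ _ (good_iter _ hJ _ _ good_base)))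
  rw [ht] at hw
  intro c
  have := hw (c / 2 ^ k)
  have e : (c / 2 ^ k) • vec (psmul (2 ^ k) P) = c • vec P := by
    have h2 : (2 : ℝ) ^ k ≠ 0 := by positivity
    funext i
    fin_cases i <;> · simp [vec, psmul, ez]; field_simp
  rwa [e] at this

theorem mem_pts_half (s : ℤ × ℤ × ℤ) (h : s ∈ ([1, -1] ×ˢ ([1, -1] ×ˢ [1, -1]) : List (ℤ × ℤ × ℤ))) :
    ((1, 0), (s.1, 0), (s.2.1, 0), (s.2.2, 0)) ∈ pts := by
  revert s; decide +kernel

def bas (s₁ s₂ : ℤ) : Fin 4 → Zp := ![(0, 1), (s₁, 0), (-s₂, s₂), (0, 0)]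

theorem mem_pts_perm : ∀ σ : Equiv.Perm (Fin 4), Equiv.Perm.sign σ = 1 →
    ∀ s₁ ∈ [(1 : ℤ), -1], ∀ s₂ ∈ [(1 : ℤ), -1],
    (bas s₁ s₂ (σ 0), bas s₁ s₂ (σ 1), bas s₁ s₂ (σ 2), bas s₁ s₂ (σ 3)) ∈ pts := by
  decide +kernel

theorem config_pts (v : Fin 4 → ℝ) (hv : v ∈ H4Config) :
    ∃ P ∈ pts, ∃ c : ℝ, v = c • vec P := by
  have sgn : ∀ ε : ℝ, (ε = 1 ∨ ε = -1) → ∃ s ∈ [(1 : ℤ), -1], ε = (s : ℝ) := by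
    rintro ε (rfl | rfl)
    · exact ⟨1, by simp, by simp⟩
    · exact ⟨-1, by simp, by simp⟩
  rcases hv with (⟨i, rfl⟩ | ⟨h0, h⟩) | ⟨σ, hσ, ε₁, ε₂, h1, h2, rfl⟩
  · fin_cases i
    · refine ⟨((2, 0), (0, 0), (0, 0), (0, 0)), by decide +kernel, 1 / 2, ?_⟩
      funext j; fin_cases j <;> simp [vec, ez]
    · refine ⟨((0, 0), (2, 0), (0, 0), (0, 0)), by decide +kernel, 1 / 2, ?_⟩
      funext j; fin_cases j <;> simp [vec, ez]
    · refine ⟨((0, 0), (0, 0), (2, 0), (0, 0)), by decide +kernel, 1 / 2, ?_⟩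
      funext j; fin_cases j <;> simp [vec, ez]
    · refine ⟨((0, 0), (0, 0), (0, 0), (2, 0)), by decide +kernel, 1 / 2, ?_⟩
      funext j; fin_cases j <;> simp [vec, ez]
  · obtain ⟨a, ha, ha'⟩ := sgn _ (h 1 (by decide))
    obtain ⟨b, hb, hb'⟩ := sgn _ (h 2 (by decide))
    obtain ⟨c, hc, hc'⟩ := sgn _ (h 3 (by decide))
    refine ⟨_, mem_pts_half (a, b, c)
      (List.mem_product.2 ⟨ha, List.mem_product.2 ⟨hb, hc⟩⟩), 1, ?_⟩
    funext j; fin_cases j <;> simp [vec, ez, h0, ha', hb', hc']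
  · obtain ⟨a, ha, rfl⟩ := sgn _ h1
    obtain ⟨b, hb, rfl⟩ := sgn _ h2
    refine ⟨_, mem_pts_perm σ hσ a ha b hb, 1, ?_⟩
    have key : ∀ k : Fin 4, (![gr, (a : ℝ), (b : ℝ) * gr⁻¹, 0] : Fin 4 → ℝ) k
        = ez gr (bas a b k) := by
      intro k
      rw [gr_inv]
      fin_cases k <;> simp [bas, ez]
      ring
    funext j
    rw [one_smul, key]
    fin_cases j <;> rfl

/-! ### Homogeneity and nonvanishing -/

theorem ell_hom (P : Pt) : (ell (C gr : MvPolynomial (Fin 4) ℝ) (X 0) (X 1) (X 2) (X 3) P).IsHomogeneous 1 := by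
  simp only [ell, lin3, ez_C]
  have h : ∀ (a : ℝ) (i : Fin 4), (C a * X i : MvPolynomial (Fin 4) ℝ).IsHomogeneous 1 := by
    intro a i
    simpa using (isHomogeneous_C (Fin 4) a).mul (isHomogeneous_X ℝ i)
  exact (h _ _).add (((h _ _).add (h _ _)).add (h _ _))

theorem ps_hom (n : ℕ) :
    (ps n (C gr : MvPolynomial (Fin 4) ℝ) (X 0) (X 1) (X 2) (X 3)).IsHomogeneous n := by
  unfold ps
  induction pts with
  | nil => simpa using isHomogeneous_zero (Fin 4) ℝ n
  | cons P l ih =>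
    rw [List.map_cons, List.sum_cons]
    refine IsHomogeneous.add ?_ ih
    simpa using (ell_hom P).pow n

theorem FF_hom : FF.IsHomogeneous 36 := by
  have hs : (sq4 (X 0) (X 1) (X 2) (X 3) : MvPolynomial (Fin 4) ℝ).IsHomogeneous 2 := by
    have h : ∀ i : Fin 4, (X i ^ 2 : MvPolynomial (Fin 4) ℝ).IsHomogeneous 2 := fun i => by
      simpa using (isHomogeneous_X ℝ i).pow 2
    exact (((h 0).add (h 1)).add (h 2)).add (h 3)
  have hc : ∀ (k : ℤ) (p : MvPolynomial (Fin 4) ℝ), p.IsHomogeneous 36 →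
      ((k : MvPolynomial (Fin 4) ℝ) * p).IsHomogeneous 36 := by
    intro k p hp
    have e : (k : MvPolynomial (Fin 4) ℝ) = C (k : ℝ) := by simp
    rw [e]
    simpa using (isHomogeneous_C (Fin 4) (k : ℝ)).mul hp
  have a := ps_hom 12
  have b := ps_hom 20
  have c := ps_hom 30
  unfold FF F36 comb36
  refine IsHomogeneous.add (IsHomogeneous.add (IsHomogeneous.add (IsHomogeneous.add
    (IsHomogeneous.add (IsHomogeneous.add ?_ ?_) ?_) ?_) ?_) ?_) ?_ <;> apply hc
  · exact hs.pow 18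
  · exact (hs.pow 12).mul a
  · exact (hs.pow 6).mul (a.pow 2)
  · exact a.pow 3
  · exact (hs.pow 8).mul b
  · exact ((hs.pow 2).mul a).mul b
  · exact (hs.pow 3).mul c

def psZ (n : ℕ) : Zp := (pts.map (fun P => zpow (zadd P.1 P.2.1) n)).foldr zadd (0, 0)

theorem psZ_12 : psZ 12 = (1011360, 0) := by decide +kernel
theorem psZ_20 : psZ 20 = (1921680000, 0) := by decide +kernel
theorem psZ_30 : psZ 30 = (27948692642880, 0) := by decide +kernel

theorem ps_eval (n : ℕ) : ps n gr 1 1 0 0 = ez gr (psZ n) := by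
  unfold ps psZ
  induction pts with
  | nil => simp [ez]
  | cons P l ih =>
    rw [List.map_cons, List.sum_cons, List.map_cons, List.foldr_cons, ez_add, ih, ez_pow gr gr_sq,
      ez_add]
    simp [ell, lin3]

theorem FF_ne : FF ≠ 0 := by
  intro h
  have e := congrArg (eval (![1, 1, 0, 0] : Fin 4 → ℝ)) h
  rw [FF, F36_map] at e
  simp only [eval_X, eval_C, map_zero] at e
  simp only [Matrix.cons_val_zero, Matrix.cons_val_one, Matrix.cons_val] at e
  rw [F36, ps_eval, ps_eval, ps_eval, psZ_12, psZ_20, psZ_30] at e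
  norm_num [comb36, sq4, ez] at e

/-- There is a nonzero homogeneous polynomial of degree 36 vanishing to order at least 10
at every point of the H4 configuration; in particular `α(I(H4)^{(10)}) ≤ 36`. -/
theorem H4_degree36_mult10 :
    (∃ F : MvPolynomial (Fin 4) ℝ, F ≠ 0 ∧ F.IsHomogeneous 36 ∧
      ∀ v ∈ H4Config, vanishesToOrderR F v 10) ∧
    alphaSymbolicR H4Config 10 ≤ 36 := by

  have h : ∃ F : MvPolynomial (Fin 4) ℝ, F ≠ 0 ∧ F.IsHomogeneous 36 ∧
      ∀ v ∈ H4Config, vanishesToOrderR F v 10 := by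
    refine ⟨FF, FF_ne, FF_hom, fun v hv => ?_⟩
    obtain ⟨P, hP, c, rfl⟩ := config_pts v hv
    exact vanishes_of_mem _ _ _ (good_pts P hP c)
  exact ⟨h, Nat.sInf_le h⟩
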